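/- Let X be a separable Banach space. Then C(X) < ω₁ (i.e., for every ε > 0 there exists a countable ordinal α with γ_ε^α(B_X) = ∅) if and only if X has the Slice Point of Continuity Property. -/

import Mathlib

open Metric Set Topology

noncomputable section

/-- Transfinite iteration of a derivation `d` starting from `a`;
meets are taken at limit stages. -/
def derivIter {L : Type*} [CompleteLattice L] (d : L → L) (a : L) (α : Ordinal) : L :=
  Ordinal.limitRecOn α a (fun _ ih => d ih) (fun o _ ih => ⨅ (γ : Ordinal) (h : γ < o), ih γ h)

/-- The weak topology of a real normed space. -/
def weakTop (X : Type*) [NormedAddCommGroup X] [NormedSpace ℝ X] : TopologicalSpace X :=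
  TopologicalSpace.induced (fun (x : X) (f : X →L[ℝ] ℝ) => f x) inferInstance

variable {X : Type*} [NormedAddCommGroup X] [NormedSpace ℝ X]

/-- The dentability derivation `d_ε^1`. -/
def dentDeriv (ε : ℝ) (C : Set X) : Set X :=
  C \ ⋃ (f : X →L[ℝ] ℝ) (a : ℝ) (_ : Metric.diam ({y | a < f y} ∩ C) < ε), {y | a < f y}

/-- The weak fragmentation derivation `σ_ε^1`. -/
def weakDeriv (ε : ℝ) (C : Set X) : Set X :=
  C \ ⋃ (V : Set X) (_ : IsOpen[weakTop X] V) (_ : Metric.diam (V ∩ C) < ε), V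

/-- The convex weak fragmentation derivation `γ_ε^1`. -/
def convDeriv (ε : ℝ) (C : Set X) : Set X :=
  closure (convexHull ℝ (weakDeriv ε C))

/-- `treeRoot C δ α x` : `x` is the root of a `δ`-`α`-tree contained in `C`. -/
def treeRoot (C : Set X) (δ : ℝ) (α : Ordinal) : X → Prop :=
  Ordinal.limitRecOn α (fun x => x ∈ C)
    (fun _ ih x => x ∈ C ∧ ∃ y z : X,
      x = (2⁻¹ : ℝ) • (y + z) ∧ δ ≤ 2⁻¹ * ‖y - z‖ ∧ ih y ∧ ih z)
    (fun o _ ih x => ∀ γ (h : γ < o), ih γ h x)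

/-- `sprawlRoot C δ α x` : `x` is the root of a `δ`-`α`-sprawling tree contained in `C`. -/
def sprawlRoot (C : Set X) (δ : ℝ) (α : Ordinal) : X → Prop :=
  Ordinal.limitRecOn α (fun x => x ∈ C)
    (fun _ ih x => x ∈ C ∧ ∃ y z : ℕ → X,
      (∀ n, x = (2⁻¹ : ℝ) • (y n + z n)) ∧
      (∀ n m, n ≠ m → δ ≤ ‖y n - y m‖) ∧
      (∀ n, ih (y n)) ∧ (∀ n, ih (z n)))
    (fun o _ ih x => ∀ γ (h : γ < o), ih γ h x)

/-- `bushRoot C δ α x` : `x` is the root of a `δ`-`α`-bush contained in `C`. -/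
def bushRoot (C : Set X) (δ : ℝ) (α : Ordinal) : X → Prop :=
  Ordinal.limitRecOn α (fun x => x ∈ C)
    (fun _ ih x => x ∈ C ∧ ∃ (n : ℕ) (y : Fin (n + 1) → X) (lam : Fin (n + 1) → ℝ),
      (∀ i, 0 < lam i ∧ lam i ≤ 1) ∧ (∑ i, lam i = 1) ∧
      x = ∑ i, lam i • y i ∧ (∀ i, δ ≤ ‖x - y i‖) ∧ ∀ i, ih (y i))
    (fun o _ ih x => ∀ γ (h : γ < o), ih γ h x)

/-- `X` has the Slice Point of Continuity Property. -/
def SlicePCP (X : Type*) [NormedAddCommGroup X] [NormedSpace ℝ X] : Prop :=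
  ∀ A : Set X, A.Nonempty → Bornology.IsBounded A → ∀ ε > (0 : ℝ),
    ∃ (f : X →L[ℝ] ℝ) (a : ℝ), ({y | a < f y} ∩ A).Nonempty ∧
      ∀ x ∈ {y | a < f y} ∩ A, ∃ V ∈ @nhds X (weakTop X) x, Metric.diam (V ∩ A) < ε

/-- A decreasing transfinite sequence of closed sets in a second countable space is stationary
at some countable stage. -/
theorem exists_lt_aleph_one_ord_subset_add_one {Y : Type*} [TopologicalSpace Y]
    [SecondCountableTopology Y] (F : Ordinal → Set Y) (hF : ∀ α, IsClosed (F α))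
    (hanti : Antitone F) : ∃ α < (Cardinal.aleph 1).ord, F α ⊆ F (α + 1) := by
  by_contra! h
  have key : ∀ α : Iio (Cardinal.aleph 1).ord, ∃ u : TopologicalSpace.countableBasis Y,
      (u.1 ∩ F α).Nonempty ∧ u.1 ∩ F (α + 1) = ∅ := by
    rintro ⟨α, hα⟩
    obtain ⟨x, hx, hx'⟩ := not_subset.1 (h α hα)
    obtain ⟨u, hu, hxu, hsub⟩ :=
      (TopologicalSpace.isBasis_countableBasis Y).exists_subset_of_mem_open
        (mem_compl hx') (hF (α + 1)).isOpen_compl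
    exact ⟨⟨u, hu⟩, ⟨x, hxu, hx⟩, (disjoint_compl_left.mono_left hsub).inter_eq⟩
  choose u hu hu' using key
  have hne : ∀ α β, α < β → u α ≠ u β := by
    intro α β hαβ heq
    obtain ⟨x, hxu, hx⟩ := hu β
    have hle : (α : Ordinal) + 1 ≤ β := Order.add_one_le_of_lt hαβ
    exact (hu' α).subset ⟨heq ▸ hxu, hanti hle hx⟩
  have hinj : Function.Injective u := fun α β heq => by
    rcases lt_trichotomy α β with hlt | rfl | hlt
    · exact absurd heq (hne _ _ hlt)
    · rfl
    · exact absurd heq.symm (hne _ _ hlt)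
  have hcount : Countable (Iio (Cardinal.aleph 1).ord) := by
    have := (TopologicalSpace.countable_countableBasis Y).to_subtype
    exact hinj.countable
  have hcard := Cardinal.mk_le_aleph0_iff.2 hcount
  rw [Cardinal.mk_Iio_ordinal, Cardinal.card_ord, Cardinal.lift_le_aleph0] at hcard
  exact absurd hcard (not_le.2 Cardinal.aleph0_lt_aleph_one)

section DerivIter

variable {L : Type*} [CompleteLattice L] (d : L → L) (a : L)

theorem derivIter_zero : derivIter d a 0 = a := by
  simp [derivIter]

theorem derivIter_add_one (α : Ordinal) : derivIter d a (α + 1) = d (derivIter d a α) := by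
  simp [derivIter]

theorem derivIter_limit {o : Ordinal} (ho : Order.IsSuccLimit o) :
    derivIter d a o = ⨅ (γ : Ordinal) (_ : γ < o), derivIter d a γ := by
  simp [derivIter, ho]

end DerivIter

theorem mem_derivIter_limit {Y : Type*} {d : Set Y → Set Y} {a : Set Y} {o : Ordinal}
    (ho : Order.IsSuccLimit o) {x : Y} :
    x ∈ derivIter d a o ↔ ∀ γ < o, x ∈ derivIter d a γ := by
  rw [derivIter_limit d a ho]
  simp

theorem weakDeriv_subset (ε : ℝ) (C : Set X) : weakDeriv ε C ⊆ C := sdiff_subset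

theorem mem_weakDeriv {ε : ℝ} {C : Set X} {x : X} :
    x ∈ weakDeriv ε C ↔ x ∈ C ∧ ∀ V, IsOpen[weakTop X] V → x ∈ V → ε ≤ diam (V ∩ C) := by
  simp only [weakDeriv, mem_sdiff, mem_iUnion, not_exists, exists_prop, not_and]
  refine and_congr_right fun _ => forall_congr' fun V => ?_
  rw [← not_lt]
  tauto

theorem convex_convDeriv (ε : ℝ) (C : Set X) : Convex ℝ (convDeriv ε C) :=
  (convex_convexHull ℝ _).closure

theorem convDeriv_subset {ε : ℝ} {C D : Set X} (hD : Convex ℝ D) (hD' : IsClosed D)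
    (h : weakDeriv ε C ⊆ D) : convDeriv ε C ⊆ D :=
  closure_minimal (convexHull_min h hD) hD'

theorem subset_convDeriv (ε : ℝ) (C : Set X) : weakDeriv ε C ⊆ convDeriv ε C :=
  (subset_convexHull ℝ _).trans subset_closure

section ConvDerivIter

variable {B : Set X} (ε : ℝ)

theorem isClosed_derivIter_convDeriv (hB : IsClosed B) (α : Ordinal) :
    IsClosed (derivIter (convDeriv ε) B α) := by
  induction α using Ordinal.limitRecOn with
  | zero => rwa [derivIter_zero]
  | add_one α _ => rw [derivIter_add_one]; exact isClosed_closure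
  | limit o ho ih =>
    rw [derivIter_limit _ _ ho]
    exact isClosed_biInter ih

theorem convex_derivIter_convDeriv (hB : Convex ℝ B) (α : Ordinal) :
    Convex ℝ (derivIter (convDeriv ε) B α) := by
  induction α using Ordinal.limitRecOn with
  | zero => rwa [derivIter_zero]
  | add_one α _ => rw [derivIter_add_one]; exact convex_convDeriv _ _
  | limit o ho ih =>
    rw [derivIter_limit _ _ ho]
    exact convex_iInter₂ ih

theorem antitone_derivIter_convDeriv (hB : IsClosed B) (hB' : Convex ℝ B) :
    Antitone (derivIter (convDeriv ε) B) := by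
  intro α β
  induction β using Ordinal.limitRecOn with
  | zero =>
    intro h
    rw [nonpos_iff_eq_zero.1 h]
  | add_one β ih =>
    intro h
    rcases h.eq_or_lt with rfl | h
    · exact le_rfl
    · refine le_trans ?_ (ih (Order.lt_add_one_iff.1 h))
      rw [derivIter_add_one]
      exact convDeriv_subset (convex_derivIter_convDeriv ε hB' β)
        (isClosed_derivIter_convDeriv ε hB β) (weakDeriv_subset ε _)
  | limit o ho _ =>
    intro h
    rcases h.eq_or_lt with rfl | h
    · exact le_rfl
    · exact fun x hx => (mem_derivIter_limit ho).1 hx α h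

theorem derivIter_convDeriv_subset (hB : IsClosed B) (hB' : Convex ℝ B) (α : Ordinal) :
    derivIter (convDeriv ε) B α ⊆ B := by
  simpa only [derivIter_zero] using antitone_derivIter_convDeriv ε hB hB' (zero_le (a := α))

end ConvDerivIter

theorem continuous_weakTop_apply (f : X →L[ℝ] ℝ) :
    @Continuous X ℝ (weakTop X) inferInstance (fun x => f x) :=
  @Continuous.comp X ((X →L[ℝ] ℝ) → ℝ) ℝ (weakTop X) _ _ _ _ (continuous_apply f)
    continuous_induced_dom

theorem continuous_weakTop_smul (c : ℝ) :
    @Continuous X X (weakTop X) (weakTop X) (fun x => c • x) := by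
  refine continuous_induced_rng.2
    (@continuous_pi X _ _ (weakTop X) _ _ fun f => ?_)
  simpa using continuous_weakTop_apply (c • f)

/-- If the iterated derivations exhaust `B`, every nonempty subset `A` of `B` has a slice all of
whose points have weak neighborhoods with small trace on `A`. -/
theorem exists_slice_of_derivIter_convDeriv_eq_empty {B A : Set X} {ε : ℝ} (hB : IsClosed B)
    (hB' : Convex ℝ B) (hbdd : Bornology.IsBounded B) (hA : A.Nonempty) (hAB : A ⊆ B)
    {α : Ordinal} (hα : derivIter (convDeriv ε) B α = ∅) :
    ∃ (f : X →L[ℝ] ℝ) (a : ℝ), ({y | a < f y} ∩ A).Nonempty ∧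
      ∀ x ∈ {y | a < f y} ∩ A, ∃ V ∈ @nhds X (weakTop X) x, diam (V ∩ A) < ε := by
  by_contra hno
  have hsub : ∀ β, A ⊆ derivIter (convDeriv ε) B β := by
    intro β
    induction β using Ordinal.limitRecOn with
    | zero => rwa [derivIter_zero]
    | limit o ho ih => exact fun x hx => (mem_derivIter_limit ho).2 fun γ hγ => ih γ hγ hx
    | add_one β ih =>
      intro x hx
      by_contra hxC
      rw [derivIter_add_one] at hxC
      obtain ⟨f, a, hf, hfx⟩ :=
        geometric_hahn_banach_closed_point (convex_convDeriv _ _) isClosed_closure hxC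
      refine hno ⟨f, a, ⟨x, hfx, hx⟩, fun y ⟨hfy, hy⟩ => ?_⟩
      have hyσ : y ∉ weakDeriv ε (derivIter (convDeriv ε) B β) := fun h =>
        (hf y (subset_convDeriv _ _ h)).not_gt hfy
      rw [mem_weakDeriv] at hyσ
      push Not at hyσ
      obtain ⟨V, hV, hyV, hdiam⟩ := hyσ (ih hy)
      refine ⟨V, @IsOpen.mem_nhds X (weakTop X) y V hV hyV, lt_of_le_of_lt ?_ hdiam⟩
      exact diam_mono (inter_subset_inter_right V ih)
        (hbdd.subset (inter_subset_right.trans (derivIter_convDeriv_subset ε hB hB' β)))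
  obtain ⟨x, hx⟩ := hA
  simpa [hα] using hsub α hx

/-- Under the Slice PCP, the convex weak fragmentation derivation removes a point of every nonempty
bounded set. -/
theorem SlicePCP.not_subset_convDeriv (h : SlicePCP X) {C : Set X} {ε : ℝ} (hε : 0 < ε)
    (hC : C.Nonempty) (hbdd : Bornology.IsBounded C) : ¬ C ⊆ convDeriv ε C := by
  intro hsub
  obtain ⟨f, a, ⟨x, hfx, hx⟩, hV⟩ := h C hC hbdd ε hε
  have hle : convDeriv ε C ⊆ {y | f y ≤ a} := by
    refine convDeriv_subset (convex_halfSpace_le f.toLinearMap.isLinear a)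
      (isClosed_le f.continuous continuous_const) fun y hy => ?_
    by_contra hfy
    obtain ⟨hyC, hy⟩ := mem_weakDeriv.1 hy
    obtain ⟨V, hVy, hdiam⟩ := hV y ⟨show a < f y from lt_of_not_ge hfy, hyC⟩
    obtain ⟨U, hUV, hU, hyU⟩ := (@_root_.mem_nhds_iff X (weakTop X) y V).1 hVy
    refine (hy U hU hyU).not_gt (lt_of_le_of_lt ?_ hdiam)
    exact diam_mono (inter_subset_inter_left C hUV) (hbdd.subset inter_subset_right)
  have hfx' : f x ≤ a := hle (hsub hx)
  exact hfx'.not_gt hfx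

/-- For a separable Banach space `X`: `C(X) < ω₁` (for every `ε > 0` there is a
countable ordinal `α` with `γ_ε^α(B_X) = ∅`) iff `X` has the Slice Point of Continuity
Property. -/
theorem statement3 {X : Type*} [NormedAddCommGroup X] [NormedSpace ℝ X] [CompleteSpace X]
    [TopologicalSpace.SeparableSpace X] :
    (∀ ε > (0 : ℝ), ∃ α < (Cardinal.aleph 1).ord,
        derivIter (convDeriv ε) (Metric.closedBall (0 : X) 1) α = ∅) ↔ SlicePCP X := by
  constructor
  · intro h A hA hbdd ε hε
    obtain ⟨R, hR, hAR⟩ := hbdd.subset_closedBall_lt 0 (0 : X)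
    have hAB : (fun x : X => R⁻¹ • x) '' A ⊆ closedBall 0 1 := by
      rintro _ ⟨x, hx, rfl⟩
      have hxR : ‖x‖ ≤ R := by simpa using hAR hx
      rw [mem_closedBall_zero_iff, norm_smul, norm_inv, Real.norm_of_nonneg hR.le]
      exact (inv_mul_le_one₀ hR).2 hxR
    obtain ⟨α, -, hα⟩ := h (R⁻¹ * ε) (by positivity)
    obtain ⟨f, a, ⟨_, hfx, x, hx, rfl⟩, hV⟩ := exists_slice_of_derivIter_convDeriv_eq_empty
      isClosed_closedBall (convex_closedBall 0 1) isBounded_closedBall (hA.image _) hAB hα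
    refine ⟨R⁻¹ • f, a, ⟨x, by simpa using hfx, hx⟩, fun y ⟨hfy, hy⟩ => ?_⟩
    obtain ⟨V, hVy, hdiam⟩ := hV (R⁻¹ • y) ⟨by simpa using hfy, mem_image_of_mem _ hy⟩
    refine ⟨(fun x : X => R⁻¹ • x) ⁻¹' V,
      @ContinuousAt.preimage_mem_nhds X X (weakTop X) (weakTop X) _ _ _
        (@Continuous.continuousAt X X (weakTop X) (weakTop X) _ _ (continuous_weakTop_smul R⁻¹))
        hVy, ?_⟩
    rw [← image_preimage_inter, image_smul, diam_smul₀, norm_inv,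
      Real.norm_of_nonneg hR.le, inter_comm] at hdiam
    rw [inter_comm] at hdiam
    exact lt_of_mul_lt_mul_left hdiam (inv_nonneg.2 hR.le)
  · intro h ε hε
    have hcl : IsClosed (closedBall (0 : X) 1) := isClosed_closedBall
    have hconv : Convex ℝ (closedBall (0 : X) 1) := convex_closedBall 0 1
    have : SecondCountableTopology X := UniformSpace.secondCountable_of_separable X
    obtain ⟨α, hα, hsub⟩ := exists_lt_aleph_one_ord_subset_add_one
      (derivIter (convDeriv ε) (closedBall (0 : X) 1))
      (isClosed_derivIter_convDeriv ε hcl) (antitone_derivIter_convDeriv ε hcl hconv)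
    refine ⟨α, hα, not_nonempty_iff_eq_empty.1 fun hne => ?_⟩
    rw [derivIter_add_one] at hsub
    exact h.not_subset_convDeriv hε hne
      (isBounded_closedBall.subset (derivIter_convDeriv_subset ε hcl hconv α)) hsub
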